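/- arXiv:2103.06918 — 2 statements merged into one kernel-verified Lean document; each statement's English description precedes it below -/
import Mathlib

section
/- Let k ≥ 3 and 2 ≤ i ≤ k-1, and let p = p_1 ⋯ p_n be a permutation avoiding A_{k,i}. Suppose j_1 < j_2 < ⋯ < j_{k-1} are positions with p_{j_1} < p_{j_2} < ⋯ < p_{j_{k-1}} (an increasing subsequence of length k-1). Then every entry x = p_m with m > j_{k-1} satisfies p_{j_{i-1}} < x < p_{j_i}. -/
/-- A permutation `p` of length `n` contains the pattern `q` of length `k` if there
are positions `i₁ < i₂ < ⋯ < i_k` whose entries are order-isomorphic to `q`. -/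
def Contains {n k : ℕ} (p : Equiv.Perm (Fin n)) (q : Equiv.Perm (Fin k)) : Prop :=
  ∃ f : Fin k → Fin n, StrictMono f ∧ ∀ r s : Fin k, q r < q s ↔ p (f r) < p (f s)

/-- `p` avoids every pattern in the set `S` of patterns of length `k`. -/
def AvoidsSet {n k : ℕ} (p : Equiv.Perm (Fin n)) (S : Set (Equiv.Perm (Fin k))) : Prop :=
  ∀ q ∈ S, ¬ Contains p q

/-- `A_k`: the set of patterns of length `k` whose first `k-1` entries are increasing. -/
def Ak (k : ℕ) : Set (Equiv.Perm (Fin k)) :=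
  { q | ∀ r s : Fin k, (r : ℕ) < (s : ℕ) → (s : ℕ) < k - 1 → q r < q s }

/-- `A_{k,i}`: the set `A_k` with the pattern ending in `i` removed (entries of patterns
are thought of as `1`-indexed values `1,…,k`, so value `i` corresponds to `i-1 : Fin k`). -/
def Aki (k i : ℕ) : Set (Equiv.Perm (Fin k)) :=
  { q ∈ Ak k | ∀ j : Fin k, (j : ℕ) = k - 1 → (q j : ℕ) ≠ i - 1 }

/-- The number of permutations of length `n` avoiding the set of patterns `S`. -/
noncomputable def avSet (n : ℕ) {k : ℕ} (S : Set (Equiv.Perm (Fin k))) : ℕ :=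
  Nat.card { p : Equiv.Perm (Fin n) // AvoidsSet p S }

/-- The number of permutations of length `n` avoiding the single pattern `q`. -/
noncomputable def avPat (n : ℕ) {k : ℕ} (q : Equiv.Perm (Fin k)) : ℕ :=
  Nat.card { p : Equiv.Perm (Fin n) // ¬ Contains p q }

/-- The rank of the entry in position `j` of `p`: the length of the longest increasing
subsequence of `p` ending in `p j`. -/
noncomputable def rank {n : ℕ} (p : Equiv.Perm (Fin n)) (j : Fin n) : ℕ :=
  sSup { m : ℕ | ∃ f : Fin m → Fin n, StrictMono f ∧ StrictMono (p ∘ f) ∧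
    (∀ r, f r ≤ j) ∧ (∃ r, f r = j) }

/-- Every injective sequence is order-isomorphic to a permutation, whose entries count smaller terms. -/
theorem exists_std {k n : ℕ} (h : Fin k → Fin n) (hinj : Function.Injective h) :
    ∃ q : Equiv.Perm (Fin k), (∀ r s, q r < q s ↔ h r < h s) ∧
      ∀ r, (q r : ℕ) = (Finset.univ.filter (fun s => h s < h r)).card := by
  classical
  let c : Fin k → ℕ := fun r => (Finset.univ.filter (fun s => h s < h r)).card
  have hc : ∀ r, c r < k := by
    intro r
    have : c r < (Finset.univ : Finset (Fin k)).card := by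
      apply Finset.card_lt_card
      rw [Finset.filter_ssubset]
      exact ⟨r, Finset.mem_univ _, lt_irrefl _⟩
    simpa using this
  have hlt : ∀ r s, h r < h s → c r < c s := by
    intro r s hrs
    apply Finset.card_lt_card
    rw [Finset.ssubset_iff_of_subset]
    · exact ⟨r, by simpa using hrs, by simp⟩
    · intro x hx
      simp only [Finset.mem_filter, Finset.mem_univ, true_and] at hx ⊢
      exact hx.trans hrs
  have hiff : ∀ r s, c r < c s ↔ h r < h s := by
    intro r s
    refine ⟨fun hh => ?_, hlt r s⟩
    rcases lt_trichotomy (h r) (h s) with h1 | h1 | h1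
    · exact h1
    · rw [hinj h1] at hh
      exact absurd hh (lt_irrefl _)
    · exact absurd hh (hlt s r h1).asymm
  let q0 : Fin k → Fin k := fun r => ⟨c r, hc r⟩
  have hq0 : Function.Injective q0 := by
    intro r s hrs
    have e : c r = c s := congrArg Fin.val hrs
    apply hinj
    rcases lt_trichotomy (h r) (h s) with h1 | h1 | h1
    · have := hlt r s h1
      omega
    · exact h1
    · have := hlt s r h1
      omega
  refine ⟨Equiv.ofBijective q0 (Finite.injective_iff_bijective.mp hq0), ?_, ?_⟩
  · intro r s
    exact hiff r s
  · intro r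
    rfl

/-- If `p` avoids `A_{k,i}` (`2 ≤ i ≤ k-1`) and `f` gives an increasing subsequence of
length `k-1`, then every entry after its last term lies strictly between the `(i-1)`-st
and `i`-th terms of the subsequence. -/
theorem stmt6 (k i n : ℕ) (hk : 3 ≤ k) (hi1 : 2 ≤ i) (hi2 : i ≤ k - 1)
    (p : Equiv.Perm (Fin n)) (hp : AvoidsSet p (Aki k i))
    (f : Fin (k - 1) → Fin n) (hf : StrictMono f) (hpf : StrictMono (p ∘ f))
    (m : Fin n) (hm : f ⟨k - 2, by omega⟩ < m) :
    p (f ⟨i - 2, by omega⟩) < p m ∧ p m < p (f ⟨i - 1, by omega⟩) := by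
  classical
  let g : Fin k → Fin n := fun r => if h : (r : ℕ) < k - 1 then f ⟨r, h⟩ else m
  have g1 : ∀ (r : Fin k) (h : (r : ℕ) < k - 1), g r = f ⟨r, h⟩ := fun r h => dif_pos h
  have g2 : ∀ r : Fin k, ¬ (r : ℕ) < k - 1 → g r = m := fun r h => dif_neg h
  have hg : StrictMono g := by
    intro r s hrs
    have hrs' : (r : ℕ) < s := hrs
    have hr : (r : ℕ) < k - 1 := by omega
    rw [g1 r hr]
    by_cases hs : (s : ℕ) < k - 1
    · rw [g1 s hs]
      exact hf hrs'
    · rw [g2 s hs]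
      refine lt_of_le_of_lt (hf.monotone ?_) hm
      rw [Fin.le_def]
      show (r : ℕ) ≤ k - 2
      omega
  obtain ⟨q, hq, hqc⟩ := exists_std (p ∘ g) (p.injective.comp hg.injective)
  let l : Fin k := ⟨k - 1, by omega⟩
  have hl : g l = m := g2 l (lt_irrefl _)
  have hql : (q l : ℕ) = i - 1 := by
    by_contra hne
    refine hp q ⟨?_, ?_⟩ ⟨g, hg, hq⟩
    · intro r s hrs hs
      rw [hq]
      show p (g r) < p (g s)
      rw [g1 r (hrs.trans hs), g1 s hs]
      exact hpf (Fin.lt_def.mpr hrs)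
    · intro j hj
      have : j = l := Fin.ext hj
      rwa [this]
  rw [hqc] at hql
  simp only [Function.comp_apply, hl] at hql
  have hne : ∀ r, p (f r) ≠ p m := by
    intro r e
    have e' := p.injective e
    have : f r ≤ f ⟨k - 2, by omega⟩ := hf.monotone (by
      rw [Fin.le_def]
      show (r : ℕ) ≤ k - 2
      omega)
    rw [e'] at this
    exact absurd hm this.not_gt
  constructor
  · by_contra hcon
    have hsub : Finset.univ.filter (fun s => p (g s) < p m) ⊆
        Finset.Iio (⟨i - 2, by omega⟩ : Fin k) := by
      intro s hs
      simp only [Finset.mem_filter, Finset.mem_univ, true_and] at hs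
      rw [Finset.mem_Iio]
      by_contra hs2
      have hs3 : i - 2 ≤ (s : ℕ) := not_lt.mp hs2
      by_cases h : (s : ℕ) < k - 1
      · rw [g1 s h] at hs
        have : p (f ⟨i - 2, by omega⟩) ≤ p (f ⟨s, h⟩) := hpf.monotone (Fin.le_def.mpr hs3)
        exact hcon (this.trans_lt hs)
      · rw [g2 s h] at hs
        exact lt_irrefl _ hs
    have := Finset.card_le_card hsub
    rw [hql, Fin.card_Iio] at this
    simp only at this
    omega
  · by_contra hcon
    have hlt := lt_of_le_of_ne (not_lt.mp hcon) (hne _)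
    have hsub : Finset.Iic (⟨i - 1, by omega⟩ : Fin k) ⊆
        Finset.univ.filter (fun s => p (g s) < p m) := by
      intro s hs
      simp only [Finset.mem_filter, Finset.mem_univ, true_and]
      rw [Finset.mem_Iic] at hs
      have hs3 : (s : ℕ) ≤ i - 1 := hs
      rw [g1 s (by omega)]
      have : p (f ⟨s, by omega⟩) ≤ p (f ⟨i - 1, by omega⟩) := hpf.monotone (Fin.le_def.mpr hs3)
      exact this.trans_lt hlt
    have := Finset.card_le_card hsub
    rw [hql, Fin.card_Iic] at this
    simp only at this
    omega
end

section
/- For all integers k ≥ 3 and all n ≥ 1, the number of permutations of length n avoiding A_{k,k} satisfies av_n(A_{k,k}) ≤ ((k-2)^2 + 1)^n. -/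
/-- Zero-based rank of position `j`: the number of steps in the longest increasing
subsequence ending at `j`. -/
noncomputable def rk {n : ℕ} (p : Equiv.Perm (Fin n)) (j : Fin n) : ℕ :=
  Finset.univ.sup (fun i : Fin n => if h : i < j then (if p i < p j then rk p i + 1 else 0) else 0)
termination_by j.val
decreasing_by exact h

theorem rk_lt {n : ℕ} (p : Equiv.Perm (Fin n)) {i j : Fin n} (h : i < j) (hp : p i < p j) :
    rk p i < rk p j := by
  have := Finset.le_sup (f := fun i : Fin n =>
    if h : i < j then (if p i < p j then rk p i + 1 else 0) else 0) (Finset.mem_univ i)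
  rw [rk.eq_1 p j]
  simp only [h, hp, if_true, dif_pos] at this
  exact this

theorem rk_pred {n : ℕ} (p : Equiv.Perm (Fin n)) {r : ℕ} {j : Fin n} (h : r + 1 ≤ rk p j) :
    ∃ i, i < j ∧ p i < p j ∧ r ≤ rk p i := by
  rw [rk.eq_1 p j, Finset.le_sup_iff (by simp)] at h
  obtain ⟨i, -, hi⟩ := h
  refine ⟨i, ?_⟩
  split_ifs at hi with h1 h2
  · exact ⟨h1, h2, by omega⟩
  · omega
  · omega

theorem strictMono_snoc {m n : ℕ} {f : Fin (m + 1) → Fin n} (hf : StrictMono f) {j : Fin n}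
    (h : f (Fin.last m) < j) : StrictMono (Fin.snoc f j : Fin (m + 2) → Fin n) := by
  rw [Fin.strictMono_iff_lt_succ]
  intro i
  induction i using Fin.lastCases with
  | last => simpa using h
  | cast i =>
    rw [Fin.snoc_castSucc, ← Fin.castSucc_succ, Fin.snoc_castSucc]
    exact hf i.castSucc_lt_succ

theorem rk_chain {n : ℕ} (p : Equiv.Perm (Fin n)) (r : ℕ) : ∀ j : Fin n, r ≤ rk p j →
    ∃ f : Fin (r + 1) → Fin n, StrictMono f ∧ StrictMono (p ∘ f) ∧ f (Fin.last r) = j := by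
  induction r with
  | zero =>
    intro j _
    exact ⟨fun _ => j, fun a b h => by omega, fun a b h => by omega, rfl⟩
  | succ r ih =>
    intro j hj
    obtain ⟨i, hij, hp, hi⟩ := rk_pred p hj
    obtain ⟨f, h1, h2, h3⟩ := ih i hi
    refine ⟨Fin.snoc f j, strictMono_snoc h1 (by rw [h3]; exact hij), ?_, by simp⟩
    have := strictMono_snoc h2 (j := p j) (by simpa [h3] using hp)
    rw [Fin.comp_snoc]
    exact this

theorem key {K n : ℕ} (p : Equiv.Perm (Fin n)) (hp : AvoidsSet p (Aki (K + 3) (K + 3)))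
    {j l : Fin n} (hj : K + 1 ≤ rk p j) (hl : j < l) : p j < p l := by
  by_contra hcon
  have hlt : p l < p j := lt_of_le_of_ne (not_lt.mp hcon) (fun h => hl.ne' (p.injective h))
  obtain ⟨f, h1, h2, h3⟩ := rk_chain p (K + 1) j hj
  set g : Fin (K + 3) → Fin n := Fin.snoc f l with hg
  have hgm : StrictMono g := strictMono_snoc h1 (by rw [h3]; exact hl)
  have hσ : StrictMono ((p ∘ g) ∘ Tuple.sort (p ∘ g)) :=
    (Tuple.monotone_sort (p ∘ g)).strictMono_of_injective
      ((p.injective.comp hgm.injective).comp (Tuple.sort (p ∘ g)).injective)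
  set q : Equiv.Perm (Fin (K + 3)) := (Tuple.sort (p ∘ g)).symm with hq
  have hiff : ∀ r s : Fin (K + 3), q r < q s ↔ p (g r) < p (g s) := by
    intro r s
    rw [← hσ.lt_iff_lt]
    simp [hq]
  refine hp q ⟨?_, ?_⟩ ⟨g, hgm, hiff⟩
  · intro r s hrs hs
    rw [hiff]
    obtain ⟨r', rfl⟩ : ∃ r' : Fin (K + 2), r = r'.castSucc := ⟨⟨r, by omega⟩, rfl⟩
    obtain ⟨s', rfl⟩ : ∃ s' : Fin (K + 2), s = s'.castSucc := ⟨⟨s, by omega⟩, rfl⟩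
    rw [hg, Fin.snoc_castSucc, Fin.snoc_castSucc]
    exact h2 hrs
  · intro t ht
    have et : t = Fin.last (K + 2) := by ext; simp; omega
    have : q t < q (Fin.castSucc (Fin.last (K + 1))) := by
      rw [hiff, et, hg, Fin.snoc_castSucc, Fin.snoc_last, h3]
      exact hlt
    have h' := (q (Fin.castSucc (Fin.last (K + 1)))).isLt
    have h'' : (q t : ℕ) < q (Fin.castSucc (Fin.last (K + 1))) := this
    omega

/-- Positions of small rank. -/
noncomputable def lowPos {n : ℕ} (K : ℕ) (p : Equiv.Perm (Fin n)) : Finset (Fin n) :=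
  Finset.univ.filter (fun i => rk p i < K + 1)

/-- Values of small rank. -/
noncomputable def lowVal {n : ℕ} (K : ℕ) (p : Equiv.Perm (Fin n)) : Finset (Fin n) :=
  (lowPos K p).map p.toEmbedding

theorem mem_lowVal {n K : ℕ} (p : Equiv.Perm (Fin n)) (i : Fin n) :
    p i ∈ lowVal K p ↔ rk p i < K + 1 := by
  simp [lowVal, lowPos]

theorem lt_card {n K : ℕ} (p : Equiv.Perm (Fin n)) (hp : AvoidsSet p (Aki (K + 3) (K + 3)))
    (i : Fin n) : (i : ℕ) < (lowVal K p).card ↔ rk p i < K + 1 := by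
  rw [lowVal, Finset.card_map]
  constructor
  · intro h
    by_contra hc
    have hsub : lowPos K p ⊆ Finset.Iio i := by
      intro l hl
      simp only [lowPos, Finset.mem_filter, Finset.mem_univ, true_and] at hl
      rw [Finset.mem_Iio]
      by_contra hli
      rcases (not_lt.mp hli).eq_or_lt with e | hil
      · subst e; exact hc hl
      · have := rk_lt p hil (key p hp (not_lt.mp hc) hil)
        omega
    have := Finset.card_le_card hsub
    rw [Fin.card_Iio] at this
    omega
  · intro h
    have hsub : Finset.Iic i ⊆ lowPos K p := by
      intro l hl
      rw [Finset.mem_Iic] at hl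
      simp only [lowPos, Finset.mem_filter, Finset.mem_univ, true_and]
      by_contra hc
      rcases hl.eq_or_lt with e | hil
      · subst e; exact hc h
      · have := rk_lt p hil (key p hp (not_lt.mp hc) hil)
        omega
    have := Finset.card_le_card hsub
    rw [Fin.card_Iic] at this
    omega

theorem not_lt_aux {n K : ℕ} (p p' : Equiv.Perm (Fin n))
    (hp : AvoidsSet p (Aki (K + 3) (K + 3))) (hp' : AvoidsSet p' (Aki (K + 3) (K + 3)))
    (hS : lowVal K p = lowVal K p')
    (hpos : ∀ i, rk p i < K + 1 → rk p i = rk p' i)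
    (hval : ∀ v ∈ lowVal K p, rk p (p.symm v) = rk p' (p'.symm v))
    (i : Fin n) (hi : ∀ l < i, p l = p' l) : ¬ p i < p' i := by
  intro hlt
  by_cases hr : rk p i < K + 1
  · have hr' : rk p' i < K + 1 := hpos i hr ▸ hr
    have hm : p' i ∈ lowVal K p := by rw [hS, mem_lowVal]; exact hr'
    have h1 := hval _ hm
    rw [Equiv.symm_apply_apply, ← hpos i hr] at h1
    set l := p.symm (p' i) with hl
    have hpl : p l = p' i := by simp [hl]
    rcases lt_trichotomy l i with h | h | h
    · have := hi l h
      rw [hpl] at this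
      exact h.ne' (p'.injective this)
    · rw [h] at hpl
      exact hlt.ne hpl
    · have := rk_lt p h (by rw [hpl]; exact hlt)
      omega
  · have hr' : ¬ rk p' i < K + 1 := by
      rw [← lt_card p' hp', ← hS, lt_card p hp]; exact hr
    set l := p'.symm (p i) with hl
    have hpl : p' l = p i := by simp [hl]
    rcases lt_trichotomy l i with h | h | h
    · have := hi l h
      rw [hpl] at this
      exact h.ne (p.injective this)
    · rw [h] at hpl
      exact hlt.ne' hpl
    · have := key p' hp' (not_lt.mp hr') h
      rw [hpl] at this
      exact lt_asymm this hlt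

theorem eq_of_data {n K : ℕ} (p p' : Equiv.Perm (Fin n))
    (hp : AvoidsSet p (Aki (K + 3) (K + 3))) (hp' : AvoidsSet p' (Aki (K + 3) (K + 3)))
    (hS : lowVal K p = lowVal K p')
    (hpos : ∀ i, rk p i < K + 1 → rk p i = rk p' i)
    (hval : ∀ v ∈ lowVal K p, rk p (p.symm v) = rk p' (p'.symm v)) : p = p' := by
  ext1 i
  induction i using WellFoundedLT.induction with
  | ind i ih =>
    refine le_antisymm (not_lt.mp (not_lt_aux p' p hp' hp hS.symm ?_ ?_ i
      (fun l h => (ih l h).symm))) (not_lt.mp (not_lt_aux p p' hp hp' hS hpos hval i ih))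
    · intro i h
      refine (hpos i ?_).symm
      rwa [← lt_card p hp, hS, lt_card p' hp']
    · intro v hv
      exact (hval v (hS ▸ hv)).symm

/-- `av_n(A_{k,k}) ≤ ((k-2)² + 1)ⁿ`. -/
theorem stmt8 (k n : ℕ) (hk : 3 ≤ k) (hn : 1 ≤ n) :
    avSet n (Aki k k) ≤ ((k - 2) ^ 2 + 1) ^ n := by
  classical
  obtain ⟨K, rfl⟩ : ∃ K, k = K + 3 := ⟨k - 3, by omega⟩
  have e : K + 3 - 2 = K + 1 := by omega
  rw [e, avSet, Nat.card_eq_fintype_card, Fintype.card_subtype,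
    Finset.card_eq_sum_card_fiberwise (f := lowVal K) (t := Finset.univ) (by simp)]
  have hsum := Fintype.sum_pow_mul_eq_add_pow (Fin n) ((K + 1) ^ 2) 1
  rw [Fintype.card_fin] at hsum
  rw [← hsum]
  refine Finset.sum_le_sum fun S _ => ?_
  have hc : S.card ≤ n := card_finset_fin_le S
  let F : Equiv.Perm (Fin n) → (S → Fin (K + 1)) × (Fin S.card → Fin (K + 1)) := fun p =>
    (fun v => Fin.ofNat (K + 1) (rk p (p.symm v)),
      fun i => Fin.ofNat (K + 1) (rk p ⟨i, i.isLt.trans_le hc⟩))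
  have hcard : (Finset.univ : Finset ((S → Fin (K + 1)) × (Fin S.card → Fin (K + 1)))).card
      = ((K + 1) ^ 2) ^ S.card * 1 ^ (n - S.card) := by
    rw [Finset.card_univ, Fintype.card_prod, Fintype.card_fun, Fintype.card_fun]
    simp [← pow_mul, ← pow_add, two_mul]
  rw [← hcard]
  refine Finset.card_le_card_of_injOn F (by simp) ?_
  intro p hp p' hp' hF
  simp only [Finset.coe_filter, Finset.mem_filter, Finset.mem_univ, true_and,
    Set.mem_ofPred_eq] at hp hp'
  obtain ⟨hp, hS⟩ := hp
  obtain ⟨hp', hS'⟩ := hp'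
  have hF1 := congrArg Prod.fst hF
  have hF2 := congrArg Prod.snd hF
  have hSS : lowVal K p = lowVal K p' := hS.trans hS'.symm
  refine eq_of_data p p' hp hp' hSS ?_ ?_
  · intro i hi
    have hi' : rk p' i < K + 1 := by
      rwa [← lt_card p' hp', ← hSS, lt_card p hp]
    have hlt : (i : ℕ) < S.card := by rw [← hS, lt_card p hp]; exact hi
    have := congrArg Fin.val (congrFun hF2 ⟨i, hlt⟩)
    simpa [F, Fin.ofNat, Nat.mod_eq_of_lt hi, Nat.mod_eq_of_lt hi'] using this
  · intro v hv
    have h1 : rk p (p.symm v) < K + 1 := by rw [← mem_lowVal]; simpa using hv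
    have h2 : rk p' (p'.symm v) < K + 1 := by rw [← mem_lowVal]; simpa [← hSS] using hv
    have := congrArg Fin.val (congrFun hF1 ⟨v, hS ▸ hv⟩)
    simpa [F, Fin.ofNat, Nat.mod_eq_of_lt h1, Nat.mod_eq_of_lt h2] using this
end
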